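/- arXiv:1508.06414 — 4 statements merged into one kernel-verified Lean document; each statement's English description precedes it below -/
import Mathlib

section
/- Let n be even and let Ω ⊂ ℝⁿ be a convex body with width ω. Then for every t ≥ 0, the inner parallel set satisfies |∂Ω_t| ≥ ((1 − (2(n+1)/(ω√(n+2)))·t)₊)^{n−1} · |∂Ω|. -/
open Metric MeasureTheory Set
open scoped ENNReal RealInnerProductSpace Pointwise

noncomputable section

variable {n : ℕ}

/-- The inner parallel set `Ω_t = {x ∈ Ω : dist(x, Ωᶜ) ≥ t}`. -/
def innerParallel (Ω : Set (EuclideanSpace ℝ (Fin n))) (t : ℝ) :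
    Set (EuclideanSpace ℝ (Fin n)) :=
  {x ∈ Ω | t ≤ infDist x Ωᶜ}

/-- The inradius: the radius of the largest closed ball contained in `Ω`. -/
def inradius (Ω : Set (EuclideanSpace ℝ (Fin n))) : ℝ :=
  sSup {ρ : ℝ | ∃ x, closedBall x ρ ⊆ Ω}

/-- The Minkowski difference `K ∼ L = {x : x + L ⊆ K}`. -/
def minkDiff (K L : Set (EuclideanSpace ℝ (Fin n))) : Set (EuclideanSpace ℝ (Fin n)) :=
  {x | ∀ y ∈ L, x + y ∈ K}

/-- The support function `h(Ω, u) = sup_{x ∈ Ω} ⟪x, u⟫`. -/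
def supportFn (Ω : Set (EuclideanSpace ℝ (Fin n))) (u : EuclideanSpace ℝ (Fin n)) : ℝ :=
  sSup ((fun x => ⟪x, u⟫) '' Ω)

/-- `u` is an outward unit normal of a supporting hyperplane of `Ω` at `x`. -/
def IsOuterNormalAt (Ω : Set (EuclideanSpace ℝ (Fin n)))
    (x u : EuclideanSpace ℝ (Fin n)) : Prop :=
  ‖u‖ = 1 ∧ ∀ y ∈ Ω, ⟪y, u⟫ ≤ ⟪x, u⟫

/-- `regn Ω`: outward unit normals at regular boundary points (points with a unique
supporting hyperplane, i.e. a unique outward unit normal). -/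
def regn (Ω : Set (EuclideanSpace ℝ (Fin n))) : Set (EuclideanSpace ℝ (Fin n)) :=
  {u | ∃ x ∈ frontier Ω, IsOuterNormalAt Ω x u ∧ ∀ v, IsOuterNormalAt Ω x v → v = u}

/-- The form body `Ω_* = ⋂_{u ∈ regn Ω} {x : ⟪x, u⟫ ≤ 1}`. -/
def formBody (Ω : Set (EuclideanSpace ℝ (Fin n))) : Set (EuclideanSpace ℝ (Fin n)) :=
  ⋂ u ∈ regn Ω, {x | ⟪x, u⟫ ≤ 1}

/-- The width `ω = inf {h(Ω,u) + h(Ω,−u) : u ∈ S^{n−1}}`. -/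
def width (Ω : Set (EuclideanSpace ℝ (Fin n))) : ℝ :=
  sInf ((fun u => supportFn Ω u + supportFn Ω (-u)) '' sphere (0 : EuclideanSpace ℝ (Fin n)) 1)

/-- A point outside the interior of a convex body lies on or beyond a supporting hyperplane. -/
theorem exists_supporting_normal {E : Type*} [NormedAddCommGroup E] [InnerProductSpace ℝ E]
    [CompleteSpace E] {Ω : Set E} (hconv : Convex ℝ Ω) (hint : (interior Ω).Nonempty) {y : E}
    (hy : y ∉ interior Ω) : ∃ u : E, u ≠ 0 ∧ ∀ a ∈ Ω, ⟪u, a⟫ ≤ ⟪u, y⟫ := by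
  obtain ⟨f, hf⟩ := geometric_hahn_banach_open_point hconv.interior isOpen_interior hy
  set u := (InnerProductSpace.toDual ℝ E).symm f
  have hu : ∀ a, ⟪u, a⟫ = f a := fun a => InnerProductSpace.toDual_symm_apply
  refine ⟨u, ?_, fun a ha => ?_⟩
  · rintro h0
    obtain ⟨a, ha⟩ := hint
    have := hf a ha
    rw [← hu, ← hu, h0] at this
    simp at this
  · have hmem : a ∈ closure (interior Ω) := by
      rw [hconv.closure_interior_eq_closure_of_nonempty_interior hint]
      exact subset_closure ha
    have hcl : IsClosed {b | f b ≤ f y} := isClosed_le f.continuous continuous_const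
    rw [hu, hu]
    exact closure_minimal (fun b hb => (hf b hb).le) hcl hmem

/-- A ray issuing from a point of a bounded set meets the frontier of that set. -/
theorem exists_ray_mem_frontier {E : Type*} [NormedAddCommGroup E] [NormedSpace ℝ E]
    {L : Set E} (hL : Bornology.IsBounded L) {z u : E} (hz : z ∈ L) (hu : u ≠ 0) :
    ∃ s : ℝ, 0 ≤ s ∧ z + s • u ∈ frontier L := by
  have hpre : IsPreconnected ((fun s : ℝ => z + s • u) '' Ici 0) :=
    isPreconnected_Ici.image _ (by fun_prop)
  obtain ⟨M, hM⟩ := hL.subset_closedBall z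
  have hMu : 0 < ‖u‖ := norm_pos_iff.mpr hu
  have hne : (((fun s : ℝ => z + s • u) '' Ici 0) ∩ Lᶜ).Nonempty := by
    refine ⟨_, ⟨(|M| + 1) / ‖u‖, mem_Ici.mpr (by positivity), rfl⟩, fun hmem => ?_⟩
    have := hM hmem
    rw [mem_closedBall, dist_eq_norm, add_sub_cancel_left, norm_smul, Real.norm_of_nonneg
      (by positivity), div_mul_cancel₀ _ hMu.ne'] at this
    linarith [le_abs_self M]
  by_contra! hfr
  have hcover : ∀ p ∈ (fun s : ℝ => z + s • u) '' Ici 0, p ∈ interior L ∨ p ∈ (closure L)ᶜ := by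
    rintro _ ⟨s, hs, rfl⟩
    by_contra! h
    exact hfr s hs ⟨not_not.mp h.2, h.1⟩
  obtain ⟨q, hq, hqL⟩ := hne
  obtain ⟨p, -, hp⟩ := hpre (interior L) (closure L)ᶜ isOpen_interior isClosed_closure.isOpen_compl
    hcover
    ⟨z, ⟨0, mem_Ici.mpr le_rfl, by simp⟩, (hcover z ⟨0, mem_Ici.mpr le_rfl, by simp⟩).resolve_right
      fun h => h (subset_closure hz)⟩
    ⟨q, hq, (hcover q hq).resolve_left fun h => hqL (interior_subset h)⟩
  exact hp.2 (subset_closure (interior_subset hp.1))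

/-- If a bounded set contains a homothetic copy, with ratio `c`, of a convex body, then its
perimeter is at least `c ^ d` times that of the body. -/
theorem hausdorffMeasure_frontier_le_of_homothety_subset {E : Type*} [NormedAddCommGroup E]
    [InnerProductSpace ℝ E] [CompleteSpace E] [MeasurableSpace E] [BorelSpace E] {Ω L : Set E}
    (hcl : IsClosed Ω) (hconv : Convex ℝ Ω) (hint : (interior Ω).Nonempty)
    (hL : Bornology.IsBounded L) {x₀ : E} {c : ℝ} (hc : 0 < c)
    (hsub : ∀ x ∈ Ω, x₀ + c • (x - x₀) ∈ L) {d : ℝ} (hd : 0 ≤ d) :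
    ENNReal.ofReal (c ^ d) * μH[d] (frontier Ω) ≤ μH[d] (frontier L) := by
  have hex : ∀ y : frontier Ω, ∃ u : E, ∃ s : ℝ, (∀ a ∈ Ω, ⟪u, a⟫ ≤ ⟪u, (y : E)⟫) ∧ 0 ≤ s ∧
      x₀ + c • ((y : E) - x₀) + s • u ∈ frontier L := by
    rintro ⟨y, hy⟩
    obtain ⟨u, hu, hsup⟩ := exists_supporting_normal hconv hint hy.2
    obtain ⟨s, hs, hfr⟩ := exists_ray_mem_frontier hL (hsub y (hcl.frontier_subset hy)) hu
    exact ⟨u, s, hsup, hs, hfr⟩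
  choose u s hu hs hfr using hex
  set g : frontier Ω → E := fun y => x₀ + c • ((y : E) - x₀) + s y • u y with hg
  have hanti : AntilipschitzWith (Real.toNNReal c⁻¹) g := by
    refine AntilipschitzWith.of_le_mul_dist fun y z => ?_
    rw [Real.coe_toNNReal _ (inv_nonneg.mpr hc.le), ← div_eq_inv_mul, le_div_iff₀ hc,
      Subtype.dist_eq, dist_eq_norm, dist_eq_norm]
    have hdiff : g y - g z = c • ((y : E) - z) + (s y • u y - s z • u z) := by
      simp only [hg, smul_sub]; abel
    have hy := hu y z (hcl.frontier_subset z.2)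
    have hz := hu z y (hcl.frontier_subset y.2)
    have hcross : 0 ≤ ⟪c • ((y : E) - z), s y • u y - s z • u z⟫ := by
      rw [real_inner_comm]
      simp only [inner_sub_left, inner_sub_right, real_inner_smul_left, real_inner_smul_right]
      nlinarith [mul_nonneg (mul_nonneg hc.le (hs y)) (sub_nonneg.mpr hy),
        mul_nonneg (mul_nonneg hc.le (hs z)) (sub_nonneg.mpr hz)]
    have hsq : ‖c • ((y : E) - z)‖ ^ 2 ≤ ‖g y - g z‖ ^ 2 := by
      rw [hdiff, norm_add_sq_real]
      nlinarith [sq_nonneg ‖s y • u y - s z • u z‖]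
    have := le_of_sq_le_sq hsq (norm_nonneg _)
    rwa [norm_smul, Real.norm_of_nonneg hc.le, mul_comm] at this
  have hle := hanti.le_hausdorffMeasure_image hd univ
  have huniv : μH[d] (univ : Set (frontier Ω)) = μH[d] (frontier Ω) := by
    rw [← (isometry_subtype_coe (s := frontier Ω)).hausdorffMeasure_image (Or.inl hd), image_univ,
      Subtype.range_coe]
  have himage : g '' univ ⊆ frontier L := by
    rintro _ ⟨y, -, rfl⟩
    exact hfr y
  rw [huniv] at hle
  have hcoef : ENNReal.ofReal (c ^ d) * ((Real.toNNReal c⁻¹ : ℝ≥0∞) ^ d) = 1 := by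
    change ENNReal.ofReal (c ^ d) * (ENNReal.ofReal c⁻¹) ^ d = 1
    rw [ENNReal.ofReal_rpow_of_nonneg (inv_nonneg.mpr hc.le) hd,
      ← ENNReal.ofReal_mul (by positivity), ← Real.mul_rpow hc.le (inv_nonneg.mpr hc.le),
      mul_inv_cancel₀ hc.ne', Real.one_rpow, ENNReal.ofReal_one]
  calc ENNReal.ofReal (c ^ d) * μH[d] (frontier Ω)
      ≤ ENNReal.ofReal (c ^ d) * ((Real.toNNReal c⁻¹ : ℝ≥0∞) ^ d * μH[d] (g '' univ)) := by
        gcongr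
    _ = μH[d] (g '' univ) := by rw [← mul_assoc, hcoef, one_mul]
    _ ≤ μH[d] (frontier L) := measure_mono himage

/-- Vectors with zero sum and total length one have a `k`-element partial sum which is not too
short. -/
theorem exists_norm_sum_sq_ge {E ι : Type*} [NormedAddCommGroup E] [InnerProductSpace ℝ E]
    [Fintype ι] [DecidableEq ι] (w : ι → E) (hsum : ∑ i, w i = 0) (hnorm : ∑ i, ‖w i‖ = 1)
    (A : Finset ι) :
    ∃ I : Finset ι, (A.card : ℝ) * (Fintype.card ι - A.card) ≤
      (Fintype.card ι : ℝ) ^ 2 * (Fintype.card ι - 1) * ‖∑ i ∈ I, w i‖ ^ 2 := by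
  set N : ℝ := (Fintype.card ι : ℝ) with hN
  let G : ι → ι → ℝ := fun a b => ∑ σ : Equiv.Perm ι, ⟪w (σ a), w (σ b)⟫
  have hinv : ∀ (τ : Equiv.Perm ι) a b, G (τ a) (τ b) = G a b := fun τ a b =>
    Equiv.sum_comp (Equiv.mulRight τ) fun σ : Equiv.Perm ι => ⟪w (σ a), w (σ b)⟫
  have hdiag : ∀ a a', G a a = G a' a' := fun a a' => by
    simpa using (hinv (Equiv.swap a a') a a).symm
  have hoff : ∀ a b b', b ≠ a → b' ≠ a → G a b = G a b' := fun a b b' hb hb' => by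
    simpa [Equiv.swap_apply_of_ne_of_ne hb.symm hb'.symm] using
      (hinv (Equiv.swap b b') a b).symm
  have hrow : ∀ a, ∑ b, G a b = 0 := fun a => by
    simp only [G]
    rw [Finset.sum_comm]
    refine Finset.sum_eq_zero fun σ _ => ?_
    rw [← inner_sum, Equiv.sum_comp σ w, hsum, inner_zero_right]
  have hNe : Nonempty ι := by
    by_contra h
    rw [not_nonempty_iff] at h
    simp at hnorm
  have hG : ∀ a b, b ≠ a → (N - 1) * G a b = -G a a := fun a b hb => by
    have h1 := hrow a
    rw [← Finset.add_sum_erase _ _ (Finset.mem_univ a),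
      Finset.sum_congr rfl fun b' hb' => hoff a b' b (Finset.ne_of_mem_erase hb') hb,
      Finset.sum_const, Finset.card_erase_of_mem (Finset.mem_univ a), nsmul_eq_mul,
      Finset.card_univ, Nat.cast_pred Fintype.card_pos] at h1
    linarith
  obtain ⟨a₀⟩ := hNe
  have hP : N * G a₀ a₀ = Fintype.card (Equiv.Perm ι) * ∑ i, ‖w i‖ ^ 2 := by
    have : ∑ a, G a a = N * G a₀ a₀ := by
      rw [Finset.sum_congr rfl fun a _ => hdiag a a₀]
      simp [hN]
    rw [← this]
    simp only [G, real_inner_self_eq_norm_sq]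
    rw [Finset.sum_comm, Finset.sum_congr rfl fun σ _ => Equiv.sum_comp σ fun i => ‖w i‖ ^ 2]
    simp
  have hS : 1 ≤ N * ∑ i, ‖w i‖ ^ 2 := by
    have := sq_sum_le_card_mul_sum_sq (s := Finset.univ) (f := fun i => ‖w i‖)
    rwa [hnorm, one_pow, Finset.card_univ] at this
  have hA : (N - 1) * ∑ σ : Equiv.Perm ι, ‖∑ a ∈ A, w (σ a)‖ ^ 2 =
      A.card * (N - A.card) * G a₀ a₀ := by
    have hexp : ∑ σ : Equiv.Perm ι, ‖∑ a ∈ A, w (σ a)‖ ^ 2 = ∑ a ∈ A, ∑ b ∈ A, G a b := by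
      simp only [← real_inner_self_eq_norm_sq, sum_inner, inner_sum, G]
      rw [Finset.sum_comm]
      refine Finset.sum_congr rfl fun a _ => ?_
      rw [Finset.sum_comm]
      exact Finset.sum_congr rfl fun b _ => Finset.sum_congr rfl fun σ _ => real_inner_comm _ _
    rw [hexp, Finset.mul_sum, Finset.sum_congr rfl (g := fun _ => (N - A.card) * G a₀ a₀),
      Finset.sum_const, nsmul_eq_mul, mul_assoc]
    intro a ha
    rw [Finset.mul_sum, ← Finset.add_sum_erase _ _ ha,
      Finset.sum_congr rfl fun b hb => hG a b (Finset.ne_of_mem_erase hb), Finset.sum_const,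
      Finset.card_erase_of_mem ha, nsmul_eq_mul, Nat.cast_pred (Finset.card_pos.mpr ⟨a, ha⟩),
      hdiag a a₀]
    ring
  have hcard : (A.card : ℝ) ≤ N := Nat.cast_le.mpr (Finset.card_le_univ A)
  have htotal : ∑ _σ : Equiv.Perm ι, (A.card : ℝ) * (N - A.card) ≤
      ∑ σ : Equiv.Perm ι, N ^ 2 * (N - 1) * ‖∑ a ∈ A, w (σ a)‖ ^ 2 := by
    rw [Finset.sum_const, nsmul_eq_mul, Finset.card_univ, ← Finset.mul_sum]
    have hnn : 0 ≤ (Fintype.card (Equiv.Perm ι) : ℝ) * (A.card * (N - A.card)) :=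
      mul_nonneg (Nat.cast_nonneg _) (mul_nonneg (Nat.cast_nonneg _) (sub_nonneg.mpr hcard))
    calc (Fintype.card (Equiv.Perm ι) : ℝ) * (A.card * (N - A.card))
        ≤ (Fintype.card (Equiv.Perm ι) : ℝ) * (A.card * (N - A.card)) *
            (N * ∑ i, ‖w i‖ ^ 2) := le_mul_of_one_le_right hnn hS
      _ = N * (A.card * (N - A.card)) *
            (Fintype.card (Equiv.Perm ι) * ∑ i, ‖w i‖ ^ 2) := by ring
      _ = N ^ 2 * (A.card * (N - A.card) * G a₀ a₀) := by rw [← hP]; ring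
      _ = N ^ 2 * (N - 1) * ∑ σ : Equiv.Perm ι, ‖∑ a ∈ A, w (σ a)‖ ^ 2 := by
          rw [← hA]; ring
  obtain ⟨σ, -, hσ⟩ := Finset.exists_le_of_sum_le Finset.univ_nonempty htotal
  exact ⟨A.map σ.toEmbedding, by simpa [Finset.sum_map] using hσ⟩

/-- Carathéodory's theorem with a fixed number of points. -/
theorem exists_stdSimplex_of_mem_convexHull {E : Type*} [NormedAddCommGroup E] [NormedSpace ℝ E]
    [FiniteDimensional ℝ E] {s : Set E} {x : E} (hx : x ∈ convexHull ℝ s) :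
    ∃ w ∈ stdSimplex ℝ (Fin (Module.finrank ℝ E + 1)),
      ∃ z : Fin (Module.finrank ℝ E + 1) → E, (∀ i, z i ∈ s) ∧ ∑ i, w i • z i = x := by
  obtain ⟨y, hy⟩ := convexHull_nonempty_iff.mp ⟨x, hx⟩
  obtain ⟨ι, _, z, w, hz, hind, hw, hw1, hwz⟩ := eq_pos_convex_span_of_mem_convexHull hx
  obtain ⟨e⟩ : Nonempty (ι ↪ Fin (Module.finrank ℝ E + 1)) :=
    Function.Embedding.nonempty_of_card_le (by
      rw [Fintype.card_fin]
      exact hind.card_le_finrank_succ.trans (by gcongr; exact Submodule.finrank_le _))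
  have he := e.injective
  refine ⟨Function.extend e w 0, ⟨fun i => ?_, ?_⟩, Function.extend e z fun _ => y, fun i => ?_, ?_⟩
  · by_cases hi : ∃ a, e a = i
    · obtain ⟨a, rfl⟩ := hi
      rw [he.extend_apply]
      exact (hw a).le
    · rw [Function.extend_apply' _ _ _ hi, Pi.zero_apply]
  · rw [← hw1]
    refine (Fintype.sum_of_injective e he _ _ (fun i hi => ?_) fun a => ?_).symm
    · rw [Function.extend_apply' _ _ _ hi, Pi.zero_apply]
    · rw [he.extend_apply]
  · by_cases hi : ∃ a, e a = i
    · obtain ⟨a, rfl⟩ := hi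
      rw [he.extend_apply]
      exact hz (mem_range_self a)
    · rwa [Function.extend_apply' _ _ _ hi]
  · rw [← hwz]
    refine (Fintype.sum_of_injective e he _ _ (fun i hi => ?_) fun a => ?_).symm
    · rw [Function.extend_apply' _ _ _ hi, Pi.zero_apply, zero_smul]
    · rw [he.extend_apply, he.extend_apply]

theorem isCompact_convexHull_of_isCompact {E : Type*} [NormedAddCommGroup E] [NormedSpace ℝ E]
    [FiniteDimensional ℝ E] {s : Set E} (hs : IsCompact s) : IsCompact (convexHull ℝ s) := by
  have hcomp : IsCompact (stdSimplex ℝ (Fin (Module.finrank ℝ E + 1)) ×ˢ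
      univ.pi fun _ : Fin (Module.finrank ℝ E + 1) => s) :=
    (isCompact_stdSimplex ℝ _).prod (isCompact_univ_pi fun _ => hs)
  convert hcomp.image (f := fun p : (Fin (Module.finrank ℝ E + 1) → ℝ) ×
    (Fin (Module.finrank ℝ E + 1) → E) => ∑ i, p.1 i • p.2 i) (by fun_prop) using 1
  ext x
  constructor
  · intro hx
    obtain ⟨w, hw, z, hz, rfl⟩ := exists_stdSimplex_of_mem_convexHull hx
    exact ⟨(w, z), ⟨hw, fun i _ => hz i⟩, rfl⟩
  · rintro ⟨⟨w, z⟩, ⟨hw, hz⟩, rfl⟩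
    exact (convex_convexHull ℝ s).sum_mem (fun i _ => hw.1 i) hw.2
      fun i _ => subset_convexHull ℝ s (hz i (mem_univ i))

/-- The contact directions of a largest inscribed ball contain the origin in their convex hull. -/
theorem zero_mem_convexHull_contact {E : Type*} [NormedAddCommGroup E] [InnerProductSpace ℝ E]
    [FiniteDimensional ℝ E] {Ω : Set E} {x₀ : E} {r : ℝ} (hr : 0 < r)
    (hball : ball x₀ r ⊆ Ω) (hmax : ∀ x, ¬ closedBall x r ⊆ interior Ω) :
    (0 : E) ∈ convexHull ℝ {u : E | ‖u‖ = 1 ∧ x₀ + r • u ∉ interior Ω} := by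
  set C : Set E := {u : E | ‖u‖ = 1 ∧ x₀ + r • u ∉ interior Ω} with hC
  have hball' : ball x₀ r ⊆ interior Ω := interior_maximal hball isOpen_ball
  have hCc : IsCompact C := by
    have hcl : IsClosed {u : E | x₀ + r • u ∉ interior Ω} :=
      (isOpen_interior.isClosed_compl).preimage
        (show Continuous fun u : E => x₀ + r • u by fun_prop)
    convert (isCompact_sphere (0 : E) 1).inter_right hcl using 1
    ext u
    simp [hC]
  by_contra h0
  obtain ⟨f, c, hc0, hcf⟩ := geometric_hahn_banach_point_closed (convex_convexHull ℝ C)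
    (isCompact_convexHull_of_isCompact hCc).isClosed h0
  rw [map_zero] at hc0
  set w := (InnerProductSpace.toDual ℝ E).symm f
  have hw : ∀ u ∈ C, c < ⟪w, u⟫ := fun u hu => by
    rw [InnerProductSpace.toDual_symm_apply]
    exact hcf u (subset_convexHull ℝ C hu)
  let D : Set E := closedBall x₀ r ∩ {p | ⟪w, p - x₀⟫ ≤ c * r / 2}
  have hDc : IsCompact D := (isCompact_closedBall x₀ r).inter_right
    (isClosed_le (by fun_prop) continuous_const)
  have hDi : D ⊆ interior Ω := by
    rintro p ⟨hp, hpw⟩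
    rw [mem_closedBall, dist_eq_norm] at hp
    rcases hp.lt_or_eq with hlt | heq
    · exact hball' (by rwa [mem_ball, dist_eq_norm])
    · by_contra hpi
      have hmem : r⁻¹ • (p - x₀) ∈ C := by
        refine ⟨?_, ?_⟩
        · rw [norm_smul, heq, Real.norm_of_nonneg (by positivity), inv_mul_cancel₀ hr.ne']
        · rwa [smul_inv_smul₀ hr.ne', add_sub_cancel]
      have h1 := hw _ hmem
      rw [real_inner_smul_right, ← div_eq_inv_mul, lt_div_iff₀ hr] at h1
      have : ⟪w, p - x₀⟫ ≤ c * r / 2 := hpw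
      nlinarith [mul_pos hc0 hr]
  obtain ⟨η, hη, hηs⟩ := hDc.exists_thickening_subset_open isOpen_interior hDi
  obtain ⟨ε, hε, hε1, hε2⟩ : ∃ ε : ℝ, 0 < ε ∧ ε * ‖w‖ < η ∧ ε * ‖w‖ ^ 2 ≤ c * r := by
    have hcr := mul_pos hc0 hr
    refine ⟨min (η / (‖w‖ + 1)) (c * r / (‖w‖ ^ 2 + 1)), by positivity, ?_, ?_⟩
    · calc _ ≤ η / (‖w‖ + 1) * ‖w‖ := by gcongr; exact min_le_left _ _
        _ < η := by
          rw [div_mul_eq_mul_div, div_lt_iff₀ (by positivity)]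
          nlinarith
    · calc _ ≤ c * r / (‖w‖ ^ 2 + 1) * ‖w‖ ^ 2 := by gcongr; exact min_le_right _ _
        _ ≤ c * r := by
          rw [div_mul_eq_mul_div, div_le_iff₀ (by positivity)]
          nlinarith
  refine hmax (x₀ - ε • w) fun p hp => ?_
  rw [mem_closedBall, dist_eq_norm] at hp
  set q := p - (x₀ - ε • w) with hq
  by_cases hcase : ⟪w, q⟫ ≤ c * r / 2
  · refine hηs (mem_thickening_iff.mpr ⟨x₀ + q, ⟨?_, ?_⟩, ?_⟩)
    · simpa [mem_closedBall, dist_eq_norm] using hp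
    · simpa using hcase
    · have : p - (x₀ + q) = -(ε • w) := by rw [hq]; abel
      rwa [dist_eq_norm, this, norm_neg, norm_smul, Real.norm_of_nonneg hε.le]
  · refine hball' ?_
    have hpq : p - x₀ = q - ε • w := by rw [hq]; abel
    rw [mem_ball, dist_eq_norm, hpq]
    refine lt_of_pow_lt_pow_left₀ 2 hr.le ?_
    rw [norm_sub_sq_real, real_inner_smul_right, real_inner_comm, norm_smul,
      Real.norm_of_nonneg hε.le]
    have h1 : ‖q‖ ^ 2 ≤ r ^ 2 := by gcongr
    have h2 := mul_lt_mul_of_pos_left (not_le.mp hcase) hε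
    have h3 := mul_le_mul_of_nonneg_left hε2 hε.le
    nlinarith

/-- At a contact direction `u` of an inscribed ball, the hyperplane normal to `u` supports the
body. -/
theorem inner_le_of_contact {E : Type*} [NormedAddCommGroup E] [InnerProductSpace ℝ E]
    [CompleteSpace E] {Ω : Set E} (hconv : Convex ℝ Ω) {x₀ u : E} {r : ℝ} (hr : 0 < r)
    (hball : closedBall x₀ r ⊆ Ω) (hu : ‖u‖ = 1) (hcontact : x₀ + r • u ∉ interior Ω) :
    ∀ y ∈ Ω, ⟪u, y - x₀⟫ ≤ r := by
  have hint : (interior Ω).Nonempty := ⟨x₀, interior_mono hball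
    (ball_subset_interior_closedBall (mem_ball_self hr))⟩
  obtain ⟨w, hw, hsup⟩ := exists_supporting_normal hconv hint hcontact
  have hwn : 0 < ‖w‖ := norm_pos_iff.mpr hw
  have hmem : x₀ + (r / ‖w‖) • w ∈ Ω := hball (by
    rw [mem_closedBall, dist_eq_norm, add_sub_cancel_left, norm_smul,
      Real.norm_of_nonneg (by positivity), div_mul_cancel₀ _ hwn.ne'])
  have h1 := hsup _ hmem
  rw [inner_add_right, inner_add_right, real_inner_smul_right, real_inner_smul_right,
    real_inner_self_eq_norm_sq] at h1
  have h2 : r / ‖w‖ * ‖w‖ ^ 2 = r * ‖w‖ := by field_simp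
  have h3 : ‖w‖ ≤ ⟪w, u⟫ := by
    rw [h2] at h1
    exact le_of_mul_le_mul_left (by linarith) hr
  have h4 : ⟪w, u⟫ = ‖w‖ * ‖u‖ := le_antisymm (real_inner_le_norm w u) (by rwa [hu, mul_one])
  have h5 : w = ‖w‖ • u := by
    have := inner_eq_norm_mul_iff_real.mp h4
    rwa [hu, one_smul] at this
  intro y hy
  have h6 := hsup y hy
  rw [inner_add_right, real_inner_smul_right, h4, hu, mul_one] at h6
  have h7 : ‖w‖ * ⟪u, y - x₀⟫ ≤ ‖w‖ * r := by
    rw [← real_inner_smul_left, ← h5, inner_sub_right]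
    linarith
  exact le_of_mul_le_mul_left h7 hwn

/-- A convex body contains a largest ball; unit normals of its supporting hyperplanes at contact
points, with suitable weights, are in equilibrium. -/
theorem exists_inball_equilibrium {E : Type*} [NormedAddCommGroup E] [InnerProductSpace ℝ E]
    [FiniteDimensional ℝ E] [Nontrivial E] {Ω : Set E} (hcomp : IsCompact Ω)
    (hconv : Convex ℝ Ω) (hint : (interior Ω).Nonempty) :
    ∃ (x₀ : E) (r : ℝ), 0 < r ∧ closedBall x₀ r ⊆ Ω ∧
      ∃ w : Fin (Module.finrank ℝ E + 1) → E, ∑ i, w i = 0 ∧ ∑ i, ‖w i‖ = 1 ∧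
        ∀ i, ∀ y ∈ Ω, ⟪w i, y - x₀⟫ ≤ ‖w i‖ * r := by
  have hne : (Ωᶜ).Nonempty := by
    rw [nonempty_compl]
    rintro rfl
    exact noncompact_univ E hcomp
  obtain ⟨x₀, -, hmax⟩ := hcomp.exists_isMaxOn (hint.mono interior_subset)
    (continuous_infDist_pt Ωᶜ).continuousOn
  set r := infDist x₀ Ωᶜ with hr_def
  have hmem : ∀ x, ∃ y ∉ interior Ω, infDist x Ωᶜ = dist x y := fun x => by
    obtain ⟨y, hy, hxy⟩ := exists_mem_closure_infDist_eq_dist hne x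
    rw [closure_compl] at hy
    exact ⟨y, hy, hxy⟩
  have hr : 0 < r := by
    obtain ⟨x, hx⟩ := hint
    obtain ⟨y, hy, hxy⟩ := hmem x
    have h1 : infDist x Ωᶜ ≤ r := hmax (interior_subset hx)
    have h2 : 0 < dist x y := dist_pos.mpr fun h => hy (h ▸ hx)
    linarith
  have hball : ball x₀ r ⊆ Ω := ball_infDist_compl_subset
  have hcball : closedBall x₀ r ⊆ Ω := by
    rw [← closure_ball x₀ hr.ne']
    exact closure_minimal hball hcomp.isClosed
  have hno : ∀ x, ¬ closedBall x r ⊆ interior Ω := fun x hx => by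
    obtain ⟨y, hy, hxy⟩ := hmem x
    have h1 : infDist x Ωᶜ ≤ r := hmax (interior_subset (hx (mem_closedBall_self hr.le)))
    exact hy (hx (by rwa [mem_closedBall', ← hxy]))
  obtain ⟨a, ha, z, hz, hsum⟩ :=
    exists_stdSimplex_of_mem_convexHull (zero_mem_convexHull_contact hr hball hno)
  have hnorm : ∀ i, ‖a i • z i‖ = a i := fun i => by
    rw [norm_smul, (hz i).1, mul_one, Real.norm_of_nonneg (ha.1 i)]
  refine ⟨x₀, r, hr, hcball, fun i => a i • z i, hsum, ?_, fun i y hy => ?_⟩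
  · simp only [hnorm]
    exact ha.2
  · rw [hnorm, real_inner_smul_left]
    exact mul_le_mul_of_nonneg_left (inner_le_of_contact hconv hr hcball (hz i).1 (hz i).2 y hy)
      (ha.1 i)

theorem supportFn_le {Ω : Set (EuclideanSpace ℝ (Fin n))} (hne : Ω.Nonempty)
    {u : EuclideanSpace ℝ (Fin n)} {c : ℝ} (h : ∀ x ∈ Ω, ⟪x, u⟫ ≤ c) : supportFn Ω u ≤ c :=
  csSup_le (hne.image _) (by rintro _ ⟨x, hx, rfl⟩; exact h x hx)

theorem inner_le_supportFn {Ω : Set (EuclideanSpace ℝ (Fin n))} (hcomp : IsCompact Ω)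
    (u : EuclideanSpace ℝ (Fin n)) {x : EuclideanSpace ℝ (Fin n)} (hx : x ∈ Ω) :
    ⟪x, u⟫ ≤ supportFn Ω u :=
  le_csSup (hcomp.image (by fun_prop)).bddAbove ⟨x, hx, rfl⟩

/-- A convex body has positive width. -/
theorem width_pos [Nontrivial (EuclideanSpace ℝ (Fin n))] {Ω : Set (EuclideanSpace ℝ (Fin n))}
    (hcomp : IsCompact Ω) {x₀ : EuclideanSpace ℝ (Fin n)} {r : ℝ} (hr : 0 < r)
    (hball : closedBall x₀ r ⊆ Ω) : 0 < width Ω := by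
  refine lt_of_lt_of_le hr (le_csInf ((NormedSpace.sphere_nonempty.mpr zero_le_one).image _) ?_)
  rintro _ ⟨u, hu, rfl⟩
  rw [mem_sphere_zero_iff_norm] at hu
  have h1 := inner_le_supportFn hcomp u (hball (show x₀ + r • u ∈ closedBall x₀ r by
    simp [mem_closedBall, dist_eq_norm, norm_smul, hu, abs_of_pos hr]))
  have h2 := inner_le_supportFn hcomp (-u) (hball (mem_closedBall_self hr.le))
  rw [inner_add_left, real_inner_smul_left, real_inner_self_eq_norm_sq, hu] at h1
  rw [inner_neg_right] at h2
  linarith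

/-- Splitting an equilibrium of supporting hyperplanes into two groups bounds the width. -/
theorem width_mul_norm_sum_le {ι : Type*} [Fintype ι] [DecidableEq ι]
    {Ω : Set (EuclideanSpace ℝ (Fin n))} (hcomp : IsCompact Ω) (hne : Ω.Nonempty)
    {x₀ : EuclideanSpace ℝ (Fin n)} {r : ℝ} (hr : 0 < r) {w : ι → EuclideanSpace ℝ (Fin n)}
    (hsum : ∑ i, w i = 0) (hnorm : ∑ i, ‖w i‖ = 1)
    (hw : ∀ i, ∀ y ∈ Ω, ⟪w i, y - x₀⟫ ≤ ‖w i‖ * r) (I : Finset ι) :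
    width Ω * ‖∑ i ∈ I, w i‖ ≤ r := by
  set v := ∑ i ∈ I, w i with hv
  by_cases hv0 : v = 0
  · simp [hv0, hr.le]
  have hvn : 0 < ‖v‖ := norm_pos_iff.mpr hv0
  have hcompl : -v = ∑ i ∈ Iᶜ, w i := by
    rw [neg_eq_iff_add_eq_zero, hv, Finset.sum_add_sum_compl, hsum]
  have hbound : ∀ J : Finset ι, ∀ y ∈ Ω,
      ⟪∑ i ∈ J, w i, y - x₀⟫ ≤ (∑ i ∈ J, ‖w i‖) * r := fun J y hy => by
    rw [sum_inner, Finset.sum_mul]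
    exact Finset.sum_le_sum fun i _ => hw i y hy
  set u := ‖v‖⁻¹ • v with hu
  have hu1 : u ∈ sphere (0 : EuclideanSpace ℝ (Fin n)) 1 := by
    rw [mem_sphere_zero_iff_norm, norm_smul, norm_inv, norm_norm, inv_mul_cancel₀ hvn.ne']
  have h1 : supportFn Ω u ≤ ⟪x₀, u⟫ + ‖v‖⁻¹ * ((∑ i ∈ I, ‖w i‖) * r) := by
    refine supportFn_le hne fun x hx => ?_
    have := mul_le_mul_of_nonneg_left (hbound I x hx) (inv_nonneg.mpr hvn.le)
    rw [← hv, ← real_inner_smul_left, ← hu, inner_sub_right] at this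
    rw [real_inner_comm u x, real_inner_comm u x₀]
    linarith
  have h2 : supportFn Ω (-u) ≤ -⟪x₀, u⟫ + ‖v‖⁻¹ * ((∑ i ∈ Iᶜ, ‖w i‖) * r) := by
    refine supportFn_le hne fun x hx => ?_
    have := mul_le_mul_of_nonneg_left (hbound Iᶜ x hx) (inv_nonneg.mpr hvn.le)
    rw [← hcompl, ← real_inner_smul_left, smul_neg, ← hu, inner_sub_right, inner_neg_left,
      inner_neg_left] at this
    rw [inner_neg_right, real_inner_comm u x, real_inner_comm u x₀]
    linarith
  have hbdd : BddBelow ((fun u => supportFn Ω u + supportFn Ω (-u)) ''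
      sphere (0 : EuclideanSpace ℝ (Fin n)) 1) := by
    obtain ⟨x, hx⟩ := hne
    refine ⟨0, ?_⟩
    rintro _ ⟨u, -, rfl⟩
    have h1 := inner_le_supportFn hcomp u hx
    have h2 := inner_le_supportFn hcomp (-u) hx
    rw [inner_neg_right] at h2
    change 0 ≤ supportFn Ω u + supportFn Ω (-u)
    linarith
  have h3 : width Ω ≤ supportFn Ω u + supportFn Ω (-u) := csInf_le hbdd ⟨u, hu1, rfl⟩
  have h4 : ∑ i ∈ I, ‖w i‖ + ∑ i ∈ Iᶜ, ‖w i‖ = 1 := by rw [Finset.sum_add_sum_compl, hnorm]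
  rw [← le_div_iff₀ hvn]
  calc width Ω ≤ ‖v‖⁻¹ * ((∑ i ∈ I, ‖w i‖ + ∑ i ∈ Iᶜ, ‖w i‖) * r) := by linarith
    _ = r / ‖v‖ := by rw [h4, one_mul, div_eq_inv_mul]

/-- **Steinhagen's inequality** in even dimension: a convex body of width `ω` contains a ball of
radius at least `ω √(n+2) / (2(n+1))`. -/
theorem exists_closedBall_subset_width_le (hn : Even n) (hpos : 0 < n)
    {Ω : Set (EuclideanSpace ℝ (Fin n))} (hcomp : IsCompact Ω) (hconv : Convex ℝ Ω)
    (hint : (interior Ω).Nonempty) :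
    ∃ (x₀ : EuclideanSpace ℝ (Fin n)) (r : ℝ), closedBall x₀ r ⊆ Ω ∧ 0 < width Ω ∧
      width Ω * Real.sqrt ((n : ℝ) + 2) ≤ 2 * ((n : ℝ) + 1) * r := by
  have : Nonempty (Fin n) := ⟨⟨0, hpos⟩⟩
  obtain ⟨x₀, r, hr, hball, w, hsum, hnorm, hw⟩ := exists_inball_equilibrium hcomp hconv hint
  obtain ⟨m, rfl⟩ := hn
  have hm : (0 : ℝ) < m := by exact_mod_cast (by omega : 0 < m)
  have hfin : Module.finrank ℝ (EuclideanSpace ℝ (Fin (m + m))) = m + m :=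
    finrank_euclideanSpace_fin
  obtain ⟨A, -, hA⟩ := Finset.exists_subset_card_eq
    (s := (Finset.univ : Finset (Fin (Module.finrank ℝ (EuclideanSpace ℝ (Fin (m + m))) + 1))))
    (n := m) (by rw [Finset.card_univ, Fintype.card_fin, hfin]; omega)
  obtain ⟨I, hI⟩ := exists_norm_sum_sq_ge w hsum hnorm A
  have hwidth := width_pos hcomp hr hball
  have hle := width_mul_norm_sum_le hcomp (hint.mono interior_subset) hr hsum hnorm hw I
  refine ⟨x₀, r, hball, hwidth, ?_⟩
  set ρ := ‖∑ i ∈ I, w i‖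
  rw [hA, Fintype.card_fin, hfin] at hI
  push_cast at hI ⊢
  have hsq : (m : ℝ) + m + 2 ≤ (2 * (m + m + 1) * ρ) ^ 2 := by
    refine le_of_mul_le_mul_left ?_ hm
    nlinarith
  have hsqrt : Real.sqrt ((m : ℝ) + m + 2) ≤ 2 * (m + m + 1) * ρ :=
    Real.sqrt_le_iff.mpr ⟨by positivity, hsq⟩
  calc width Ω * Real.sqrt ((m : ℝ) + m + 2) ≤ width Ω * (2 * (m + m + 1) * ρ) := by gcongr
    _ = 2 * (m + m + 1) * (width Ω * ρ) := by ring
    _ ≤ 2 * (m + m + 1) * r := by gcongr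

/-- The inner parallel set of a convex set containing a ball of radius `r` contains the homothetic
copy of the set, with respect to the centre of the ball, with ratio `1 - c`, if `t ≤ c r`. -/
theorem homothety_mem_innerParallel {Ω : Set (EuclideanSpace ℝ (Fin n))} (hconv : Convex ℝ Ω)
    (hcompl : (Ωᶜ).Nonempty) {x₀ : EuclideanSpace ℝ (Fin n)} {r c t : ℝ}
    (hball : closedBall x₀ r ⊆ Ω) (hx₀ : x₀ ∈ Ω) (hc0 : 0 ≤ c) (hc1 : c ≤ 1) (htc : t ≤ c * r)
    {x : EuclideanSpace ℝ (Fin n)} (hx : x ∈ Ω) :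
    x₀ + (1 - c) • (x - x₀) ∈ innerParallel Ω t := by
  have hcomb : x₀ + (1 - c) • (x - x₀) = (1 - c) • x + c • x₀ := by module
  refine ⟨?_, (le_infDist hcompl).mpr fun q hq => ?_⟩
  · rw [hcomb]
    exact hconv hx hx₀ (by linarith) hc0 (by ring)
  · by_contra! hlt
    set p := x₀ + (1 - c) • (x - x₀) with hp
    have hc : 0 < c := by
      rcases hc0.lt_or_eq with h | h
      · exact h
      · subst h
        linarith [dist_nonneg (x := p) (y := q)]
    have hmem : x₀ + c⁻¹ • (q - p) ∈ Ω := hball (by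
      rw [mem_closedBall, dist_eq_norm, add_sub_cancel_left, norm_smul, norm_inv,
        Real.norm_of_nonneg hc0, ← dist_eq_norm, dist_comm, inv_mul_le_iff₀ hc]
      linarith)
    have hqe : q = (1 - c) • x + c • (x₀ + c⁻¹ • (q - p)) := by
      rw [smul_add, smul_inv_smul₀ hc.ne', hp]
      module
    exact hq (hqe ▸ hconv hx hmem (by linarith) hc0 (by ring))

/-- For even `n` and a convex body `Ω ⊂ ℝⁿ` of width `ω`,
`|∂Ω_t| ≥ ((1 − (2(n+1)/(ω√(n+2))) t)₊)^{n−1} |∂Ω|` for all `t ≥ 0`. -/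
theorem perimeter_innerParallel_ge_width_even
    (hn : Even n)
    (Ω : Set (EuclideanSpace ℝ (Fin n))) (hcomp : IsCompact Ω) (hconv : Convex ℝ Ω)
    (hint : (interior Ω).Nonempty) (ω t : ℝ) (hω : ω = width Ω) (ht : 0 ≤ t) :
    ENNReal.ofReal (max (1 - (2 * ((n : ℝ) + 1) / (ω * Real.sqrt ((n : ℝ) + 2))) * t) 0
          ^ (n - 1)) * μH[(n : ℝ) - 1] (frontier Ω) ≤
      μH[(n : ℝ) - 1] (frontier (innerParallel Ω t)) := by
  subst hω
  rcases Nat.eq_zero_or_pos n with rfl | hpos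
  · simp
  have : Nonempty (Fin n) := ⟨⟨0, hpos⟩⟩
  have hn2 : 2 ≤ n := by
    obtain ⟨m, rfl⟩ := hn
    omega
  obtain ⟨x₀, r, hball, hwidth, hr⟩ := exists_closedBall_subset_width_le hn hpos hcomp hconv hint
  have hsqrt : 0 < Real.sqrt ((n : ℝ) + 2) := Real.sqrt_pos.mpr (by positivity)
  have hden := mul_pos hwidth hsqrt
  set k : ℝ := 2 * ((n : ℝ) + 1) / (width Ω * Real.sqrt ((n : ℝ) + 2)) with hk
  have hk0 : 0 < k := by positivity
  have hkr : 1 ≤ k * r := by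
    rw [hk, div_mul_eq_mul_div, one_le_div hden]
    exact hr
  rcases le_or_gt (1 - k * t) 0 with hle | hlt
  · rw [max_eq_right hle, zero_pow (by omega), ENNReal.ofReal_zero, zero_mul]
    exact zero_le
  rw [max_eq_left hlt.le]
  have hr0 : 0 ≤ r := by nlinarith
  have hcompl : (Ωᶜ).Nonempty := by
    rw [nonempty_compl]
    rintro rfl
    exact noncompact_univ _ hcomp
  have hd : (0 : ℝ) ≤ (n : ℝ) - 1 := by
    have : (2 : ℝ) ≤ n := by exact_mod_cast hn2
    linarith
  have hmain := hausdorffMeasure_frontier_le_of_homothety_subset hcomp.isClosed hconv hint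
    (hcomp.isBounded.subset (sep_subset Ω fun x => t ≤ infDist x Ωᶜ)) hlt
    (fun x hx => homothety_mem_innerParallel hconv hcompl hball
      (hball (mem_closedBall_self hr0)) (by positivity) (by linarith)
      (by nlinarith : t ≤ k * t * r) hx) hd
  have hpow : (1 - k * t) ^ ((n : ℝ) - 1) = (1 - k * t) ^ (n - 1) := by
    rw [← Nat.cast_pred hpos, Real.rpow_natCast]
  rwa [hpow] at hmain
end
end

section
/- Let Ω ⊂ ℝⁿ be a convex body with inradius r and form body Ω_*. Then there exists x ∈ ℝⁿ such that x + r·Ω_* ⊆ Ω. -/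
open Metric MeasureTheory Set
open scoped ENNReal RealInnerProductSpace Pointwise

noncomputable section

variable {n : ℕ}

/-- A linear functional bounded by `1` on an absorbent set is bounded by its gauge. -/
theorem le_gauge_of_forall_le_one {E : Type*} [AddCommGroup E] [Module ℝ E] {K : Set E}
    (hK : Absorbent ℝ K) (f : E →ₗ[ℝ] ℝ) (hf : ∀ y ∈ K, f y ≤ 1) (x : E) : f x ≤ gauge K x := by
  refine le_of_forall_gt fun a ha => ?_
  obtain ⟨b, hb, hba, y, hy, rfl⟩ := exists_lt_of_gauge_lt hK ha
  simp only [map_smul, smul_eq_mul]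
  nlinarith [hf y hy]

/-- A functional bounded by `1` on `K` that meets the gauge where the gauge is differentiable is
its derivative there. -/
theorem eq_fderiv_gauge_of_support {E : Type*} [NormedAddCommGroup E] [NormedSpace ℝ E] {K : Set E}
    (hK : Absorbent ℝ K) {x : E} (hx : DifferentiableAt ℝ (gauge K) x) (f : E →L[ℝ] ℝ)
    (hf : ∀ y ∈ K, f y ≤ 1) (hfx : f x = gauge K x) : f = fderiv ℝ (gauge K) x := by
  have hmin : IsLocalMin (fun y => gauge K y - f y) x := Filter.Eventually.of_forall fun y => by
    have := le_gauge_of_forall_le_one hK f.toLinearMap hf y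
    simp only [ContinuousLinearMap.coe_coe] at this
    simp only [hfx, sub_self]
    linarith
  exact (sub_eq_zero.1 (hmin.hasFDerivAt_eq_zero (hx.hasFDerivAt.sub f.hasFDerivAt))).symm

/-- A point outside a closed convex neighbourhood of `0` is strictly separated from it by a
functional which is the only supporting functional at some boundary point. -/
theorem exists_unique_support_separating {E : Type*} [NormedAddCommGroup E] [NormedSpace ℝ E]
    [FiniteDimensional ℝ E] {K : Set E} (hc : Convex ℝ K) (h0 : K ∈ nhds 0) (hcl : IsClosed K)
    {z : E} (hz : z ∉ K) :
    ∃ p ∈ frontier K, ∃ f : E →L[ℝ] ℝ, (∀ y ∈ K, f y ≤ 1) ∧ f p = 1 ∧ 1 < f z ∧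
      ∀ g : E →L[ℝ] ℝ, (∀ y ∈ K, g y ≤ 1) → g p = 1 → g = f := by
  borelize E
  have habs : Absorbent ℝ K := absorbent_nhds_zero h0
  have hcont : Continuous (gauge K) := continuous_gauge hc h0
  obtain ⟨C, hC⟩ := hc.lipschitz_gauge h0
  have hgz : 1 < gauge K z := by
    by_contra! h
    exact hz (hcl.closure_eq ▸ (gauge_le_one_iff_mem_closure hc h0).1 h)
  obtain ⟨x, hxd, hx⟩ : ∃ x, DifferentiableAt ℝ (gauge K) x ∧ 1 < gauge K x - gauge K (x - z) := by
    have hopen : IsOpen {x | 1 < gauge K x - gauge K (x - z)} :=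
      isOpen_lt continuous_const (by fun_prop)
    obtain ⟨x, hx, hxd⟩ := (Measure.dense_of_ae
      (hC.ae_differentiableAt (μ := Measure.addHaar))).inter_open_nonempty _ hopen
        ⟨z, by simpa using hgz⟩
    exact ⟨x, hxd, hx⟩
  have hgx : 0 < gauge K x := by linarith [gauge_nonneg (s := K) (x - z)]
  set p := (gauge K x)⁻¹ • x with hp
  have hxp : x = gauge K x • p := by rw [hp, smul_inv_smul₀ hgx.ne']
  have hpf : p ∈ frontier K := by
    rw [← gauge_eq_one_iff_mem_frontier hc h0, hp, gauge_smul_of_nonneg (inv_nonneg.2 hgx.le),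
      smul_eq_mul, inv_mul_cancel₀ hgx.ne']
  have hint0 : (0 : E) ∈ interior K := mem_interior_iff_mem_nhds.2 h0
  obtain ⟨f, hf⟩ := geometric_hahn_banach_open_point hc.interior isOpen_interior hpf.2
  have hfp : 0 < f p := by simpa using hf 0 hint0
  have hfK : ∀ y ∈ K, f y ≤ f p := fun y hy => by
    have hy' : y ∈ closure (interior K) := by
      rw [hc.closure_interior_eq_closure_of_nonempty_interior ⟨0, hint0⟩]
      exact subset_closure hy
    exact closure_minimal (fun a ha => (hf a ha).le)
      (isClosed_le f.continuous continuous_const) hy'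
  have hsupp : ∀ g : E →L[ℝ] ℝ, (∀ y ∈ K, g y ≤ 1) → g p = 1 → g = fderiv ℝ (gauge K) x :=
    fun g hg hgp => eq_fderiv_gauge_of_support habs hxd g hg (by
      conv_lhs => rw [hxp]
      simp [hgp])
  have hle : ∀ y ∈ K, ((f p)⁻¹ • f) y ≤ 1 := fun y hy => by
    simpa using inv_mul_le_one_of_le₀ (hfK y hy) hfp.le
  have hone : ((f p)⁻¹ • f) p = 1 := by simp [hfp.ne']
  refine ⟨p, hpf, (f p)⁻¹ • f, hle, hone, ?_, fun g hg hgp => ?_⟩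
  · have h1 := le_gauge_of_forall_le_one habs ((f p)⁻¹ • f).toLinearMap hle (x - z)
    have h2 : ((f p)⁻¹ • f) x = gauge K x := by
      conv_lhs => rw [hxp]
      rw [map_smul, hone, smul_eq_mul, mul_one]
    rw [ContinuousLinearMap.coe_coe, map_sub] at h1
    linarith
  · rw [hsupp g hg hgp, hsupp _ hle hone]

/-- A closed convex set with nonempty interior is the intersection of its supporting half-spaces
at regular boundary points. -/
theorem exists_regular_point_separating {Ω : Set (EuclideanSpace ℝ (Fin n))} (hcl : IsClosed Ω)
    (hconv : Convex ℝ Ω) (hint : (interior Ω).Nonempty) {z : EuclideanSpace ℝ (Fin n)}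
    (hz : z ∉ Ω) :
    ∃ u ∈ regn Ω, ∃ p ∈ Ω, (∀ y ∈ Ω, ⟪y, u⟫ ≤ ⟪p, u⟫) ∧ ⟪p, u⟫ < ⟪z, u⟫ := by
  obtain ⟨o, ho⟩ := hint
  set φ := Homeomorph.addRight o
  have hφ : ∀ y, φ y = y + o := fun _ => rfl
  have h0 : φ ⁻¹' Ω ∈ nhds 0 :=
    φ.continuous.continuousAt.preimage_mem_nhds (by
      rw [hφ, zero_add]; exact mem_interior_iff_mem_nhds.1 ho)
  obtain ⟨p, hpf, f, hf, hfp, hfz, huniq⟩ := exists_unique_support_separating (K := φ ⁻¹' Ω)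
    (z := z - o) (hconv.translate_preimage_left o) h0 (hcl.preimage φ.continuous)
    (by simpa [hφ] using hz)
  rw [← φ.preimage_frontier, mem_preimage, hφ] at hpf
  obtain ⟨w, rfl⟩ := (InnerProductSpace.toDual ℝ _).surjective f
  simp only [InnerProductSpace.toDual_apply_apply] at hf hfp hfz
  have hw : 0 < ‖w‖ := norm_pos_iff.2 (by rintro rfl; simp at hfp)
  have hmem : ∀ y ∈ Ω, y - o ∈ φ ⁻¹' Ω := fun y hy => by simpa [hφ] using hy
  have hsupp : ∀ y ∈ Ω, ⟪y, ‖w‖⁻¹ • w⟫ ≤ ⟪p + o, ‖w‖⁻¹ • w⟫ := fun y hy => by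
    have := hf _ (hmem y hy)
    rw [inner_sub_right] at this
    simp only [inner_smul_right, inner_add_left]
    refine mul_le_mul_of_nonneg_left ?_ (inv_nonneg.2 hw.le)
    rw [real_inner_comm w y, real_inner_comm w p, real_inner_comm w o]
    linarith
  refine ⟨‖w‖⁻¹ • w, ⟨p + o, hpf, ⟨by simp [norm_smul, hw.ne'], hsupp⟩, ?_⟩, p + o,
    hcl.frontier_subset hpf, hsupp, ?_⟩
  · rintro v ⟨hv, hvs⟩
    have hvK : ∀ y ∈ φ ⁻¹' Ω, ⟪v, y⟫ ≤ ⟪v, p⟫ := fun y hy => by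
      have := hvs _ hy
      rw [hφ, inner_add_left, inner_add_left, real_inner_comm v y, real_inner_comm v p] at this
      linarith
    have hc : 0 < ⟪v, p⟫ := by
      obtain ⟨ε, hε, hball⟩ := Metric.nhds_basis_closedBall.mem_iff.1 h0
      have := hvK (ε • v) (hball (by simp [norm_smul, hv, abs_of_pos hε]))
      rw [inner_smul_right, real_inner_self_eq_norm_sq, hv] at this
      linarith
    have heq := huniq (InnerProductSpace.toDual ℝ _ ((⟪v, p⟫)⁻¹ • v))
      (fun y hy => by
        simpa [inner_smul_left] using inv_mul_le_one_of_le₀ (hvK y hy) hc.le)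
      (by simp [hc.ne'])
    rw [← (InnerProductSpace.toDual ℝ _).injective heq, norm_smul, hv, norm_inv,
      Real.norm_of_nonneg hc.le, mul_one, inv_inv, smul_inv_smul₀ hc.ne']
  · simp only [inner_smul_right]
    refine mul_lt_mul_of_pos_left ?_ (inv_pos.2 hw)
    rw [inner_sub_right] at hfz
    rw [inner_add_left, real_inner_comm w z, real_inner_comm w p, real_inner_comm w o]
    linarith

/-- A compact set with nonempty interior, other than the whole space, contains a closed ball
of radius `inradius Ω`. -/
theorem exists_closedBall_inradius_subset {Ω : Set (EuclideanSpace ℝ (Fin n))}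
    (hcomp : IsCompact Ω) (hint : (interior Ω).Nonempty) (hne : Ωᶜ.Nonempty) :
    ∃ x, closedBall x (inradius Ω) ⊆ Ω := by
  obtain ⟨o, ho⟩ := hint
  obtain ⟨x, -, hmax⟩ := hcomp.exists_isMaxOn ⟨o, interior_subset ho⟩
    (continuous_infDist_pt Ωᶜ).continuousOn
  have hpos : 0 < infDist o Ωᶜ := by
    refine (infDist_nonneg).lt_of_ne' fun h => ?_
    have := (mem_closure_iff_infDist_zero hne).2 h
    rw [closure_compl] at this
    exact this ho
  have hM : 0 < infDist x Ωᶜ := hpos.trans_le (hmax (interior_subset ho))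
  have hr : inradius Ω ≤ infDist x Ωᶜ := by
    refine Real.sSup_le ?_ hM.le
    rintro ρ ⟨y, hy⟩
    obtain hρ | hρ := lt_or_ge ρ 0
    · linarith
    refine le_trans ((le_infDist hne).2 fun q hq => ?_) (hmax (hy (mem_closedBall_self hρ)))
    by_contra! h
    exact hq (hy (mem_closedBall'.2 h.le))
  refine ⟨x, (closedBall_subset_closedBall hr).trans ?_⟩
  rw [← closure_ball x hM.ne']
  exact closure_minimal ball_infDist_compl_subset hcomp.isClosed

/-- For a convex body `Ω` with inradius `r` there exists `x` with
`x + r Ω_* ⊆ Ω`. -/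
theorem exists_homothety_formBody_subset
    (Ω : Set (EuclideanSpace ℝ (Fin n))) (hcomp : IsCompact Ω) (hconv : Convex ℝ Ω)
    (hint : (interior Ω).Nonempty) (r : ℝ) (hr : r = inradius Ω) :
    ∃ x : EuclideanSpace ℝ (Fin n), x +ᵥ r • formBody Ω ⊆ Ω := by
  obtain hne | hne := Ωᶜ.eq_empty_or_nonempty
  · exact ⟨0, by simp [compl_empty_iff.1 hne]⟩
  obtain ⟨x, hx⟩ := exists_closedBall_inradius_subset hcomp hint hne
  have hr0 : 0 ≤ r := by
    obtain ⟨o, ho⟩ := hint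
    exact hr ▸ Real.sSup_nonneg' ⟨0, ⟨o, by simpa using interior_subset ho⟩, le_rfl⟩
  rw [← hr] at hx
  refine ⟨x, ?_⟩
  rintro _ ⟨_, ⟨y, hy, rfl⟩, rfl⟩
  by_contra hz
  obtain ⟨u, hu, p, -, hsupp, hlt⟩ :=
    exists_regular_point_separating hcomp.isClosed hconv hint hz
  have hyu : ⟪y, u⟫ ≤ 1 := mem_iInter₂.1 hy u hu
  have hu1 : ‖u‖ = 1 := by
    obtain ⟨_, _, h, _⟩ := hu
    exact h.1
  have hball := hsupp (x + r • u) (hx (by simp [norm_smul, hu1, abs_of_nonneg hr0]))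
  rw [inner_add_left, real_inner_smul_left, real_inner_self_eq_norm_sq, hu1] at hball
  simp only [vadd_eq_add, inner_add_left, real_inner_smul_left] at hlt
  nlinarith
end
end

section
/- Let Ω ⊂ ℝⁿ be a convex body with form body Ω_*, and let t ≥ 0. Then the inner parallel set of the Minkowski sum Ω + t·Ω_* at distance t equals Ω, i.e. (Ω + t·Ω_*) ∼ tB = Ω. -/
open Metric MeasureTheory Set
open scoped ENNReal RealInnerProductSpace Pointwise

noncomputable section

variable {n : ℕ}

/-- If the gauge of a convex body `s` around `0` is differentiable at a point `z ∉ s`, then the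
radial projection of `z` to the boundary is a regular point, whose normal separates `z` from `s`. -/
lemma exists_regular_normal_of_differentiableAt_gauge
    {s : Set (EuclideanSpace ℝ (Fin n))} (hcomp : IsCompact s) (hconv : Convex ℝ s)
    (h0 : s ∈ nhds 0) {z : EuclideanSpace ℝ (Fin n)} (hz : z ∉ s)
    (hd : DifferentiableAt ℝ (gauge s) z) :
    ∃ y ∈ frontier s, ∃ u, IsOuterNormalAt s y u ∧ (∀ v, IsOuterNormalAt s y v → v = u) ∧
      ⟪y, u⟫ < ⟪z, u⟫ := by
  have mem_of_gauge : ∀ w, gauge s w ≤ 1 → w ∈ s := fun w hw => by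
    have := (gauge_le_one_iff_mem_closure hconv h0).1 hw
    rwa [hcomp.isClosed.closure_eq] at this
  have hg : 1 < gauge s z := by
    by_contra! h
    exact hz (mem_of_gauge z h)
  have hg0 : 0 < gauge s z := one_pos.trans hg
  obtain ⟨y, hy⟩ : ∃ y, y = (gauge s z)⁻¹ • z := ⟨_, rfl⟩
  have hzy : z = gauge s z • y := by rw [hy, smul_inv_smul₀ hg0.ne']
  have hgy : gauge s y = 1 := by
    rw [hy, gauge_smul_of_nonneg (by positivity), smul_eq_mul, inv_mul_cancel₀ hg0.ne']
  have hyf : y ∈ frontier s := (gauge_eq_one_iff_mem_frontier hconv h0).1 hgy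
  have inner_pos : ∀ v, IsOuterNormalAt s y v → 0 < ⟪y, v⟫ := fun v hv => by
    obtain ⟨ε, hε, hball⟩ := Metric.nhds_basis_closedBall.mem_iff.1 h0
    have hmem : ε • v ∈ s := hball (by simp [norm_smul, hv.1, abs_of_pos hε])
    have := hv.2 _ hmem
    rw [real_inner_smul_left, real_inner_self_eq_norm_sq, hv.1] at this
    linarith
  have inner_le : ∀ v, IsOuterNormalAt s y v → ∀ w, ⟪w, v⟫ ≤ ⟪y, v⟫ * gauge s w :=
    fun v hv w => by
    rcases eq_or_ne w 0 with rfl | hw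
    · simp
    have hgw : 0 < gauge s w :=
      (gauge_pos (absorbent_nhds_zero h0)
        (NormedSpace.isVonNBounded_of_isBounded ℝ hcomp.isBounded)).2 hw
    have hmem : (gauge s w)⁻¹ • w ∈ s := mem_of_gauge _ (by
      rw [gauge_smul_of_nonneg (by positivity), smul_eq_mul, inv_mul_cancel₀ hgw.ne'])
    have := hv.2 _ hmem
    rwa [real_inner_smul_left, inv_mul_le_iff₀ hgw, mul_comm] at this
  have deriv_eq : ∀ v, IsOuterNormalAt s y v →
      ∀ w, ⟪y, v⟫ * fderiv ℝ (gauge s) z w = ⟪v, w⟫ := fun v hv w => by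
    have hder := (hd.hasFDerivAt.const_mul ⟪y, v⟫).sub (innerSL ℝ v).hasFDerivAt
    have hmin : IsLocalMin ((fun w => ⟪y, v⟫ * gauge s w) - ⇑(innerSL ℝ v)) z := by
      refine Filter.Eventually.of_forall fun w => ?_
      have h1 : ⟪z, v⟫ = gauge s z * ⟪y, v⟫ := by
        conv_lhs => rw [hzy, real_inner_smul_left]
      have h2 := inner_le v hv w
      simp only [Pi.sub_apply, innerSL_apply_apply, real_inner_comm _ v]
      linarith
    have := DFunLike.congr_fun (hmin.hasFDerivAt_eq_zero hder) w
    simp at this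
    linarith
  obtain ⟨f, hf⟩ := geometric_hahn_banach_open_point hconv.interior isOpen_interior hyf.2
  have hfle : ∀ w ∈ s, f w ≤ f y := by
    have hcl : s ⊆ closure (interior s) := by
      rw [hconv.closure_interior_eq_closure_of_nonempty_interior
        ⟨0, mem_interior_iff_mem_nhds.2 h0⟩]
      exact subset_closure
    exact fun w hw => closure_minimal (fun a ha => (hf a ha).le)
      (isClosed_le f.continuous continuous_const) (hcl hw)
  have hf0 : 0 < f y := by simpa using hf 0 (mem_interior_iff_mem_nhds.2 h0)
  set a := (InnerProductSpace.toDual ℝ _).symm f with ha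
  have hfa : ∀ w, ⟪w, a⟫ = f w := fun w => by
    rw [real_inner_comm, ha, InnerProductSpace.toDual_symm_apply]
  have ha0 : 0 < ‖a‖ := norm_pos_iff.2 fun h => by
    have := hfa y
    rw [h, inner_zero_right] at this
    linarith
  obtain ⟨u, hu⟩ : ∃ u, IsOuterNormalAt s y u := by
    refine ⟨‖a‖⁻¹ • a, by rw [norm_smul, norm_inv, norm_norm, inv_mul_cancel₀ ha0.ne'], fun w hw => ?_⟩
    rw [real_inner_smul_right, real_inner_smul_right, hfa, hfa]
    exact mul_le_mul_of_nonneg_left (hfle w hw) (by positivity)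
  refine ⟨y, hyf, _, hu, fun v hv => ?_, ?_⟩
  · have hv0 := inner_pos v hv
    have hu0 := inner_pos u hu
    have heq : ⟪y, u⟫ • v = ⟪y, v⟫ • u := by
      refine ext_inner_right ℝ fun w => ?_
      rw [real_inner_smul_left, real_inner_smul_left, ← deriv_eq v hv, ← deriv_eq u hu]
      ring
    have hnorm := congrArg norm heq
    rw [norm_smul, norm_smul, hv.1, hu.1, mul_one, mul_one, Real.norm_of_nonneg hu0.le,
      Real.norm_of_nonneg hv0.le] at hnorm
    rw [hnorm] at heq
    exact smul_right_injective _ hv0.ne' heq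
  · have := inner_pos _ hu
    conv_rhs => rw [hzy, real_inner_smul_left]
    nlinarith

/-- Every nonempty open set disjoint from a convex body contains a point strictly separated from
the body by a supporting hyperplane at a regular point. -/
lemma exists_regular_normal_of_isOpen
    {Ω : Set (EuclideanSpace ℝ (Fin n))} (hcomp : IsCompact Ω) (hconv : Convex ℝ Ω)
    (hint : (interior Ω).Nonempty) {U : Set (EuclideanSpace ℝ (Fin n))} (hU : IsOpen U)
    (hne : U.Nonempty) (hdisj : Disjoint U Ω) :
    ∃ z ∈ U, ∃ y ∈ frontier Ω, ∃ u, IsOuterNormalAt Ω y u ∧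
      (∀ v, IsOuterNormalAt Ω y v → v = u) ∧ ⟪y, u⟫ < ⟪z, u⟫ := by
  obtain ⟨p, hp⟩ := hint
  let e := Homeomorph.addLeft p
  have he : ∀ w, e w = p + w := fun _ => rfl
  have hs0 : e ⁻¹' Ω ∈ nhds 0 := by
    refine e.continuous.continuousAt.preimage_mem_nhds ?_
    rw [he, add_zero]
    exact mem_interior_iff_mem_nhds.1 hp
  have hsconv : Convex ℝ (e ⁻¹' Ω) := hconv.translate_preimage_right p
  have hscomp : IsCompact (e ⁻¹' Ω) := e.isCompact_preimage.2 hcomp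
  obtain ⟨K, hK⟩ := hsconv.lipschitz_gauge hs0
  have hdense := Measure.dense_of_ae (hK.ae_differentiableAt (μ := volume))
  obtain ⟨z, hzU, hz⟩ := hdense.exists_mem_open (hU.preimage e.continuous)
    (hne.preimage e.surjective)
  obtain ⟨y, hy, u, hu, huniq, hlt⟩ := exists_regular_normal_of_differentiableAt_gauge hscomp
    hsconv hs0 (fun h => disjoint_left.1 hdisj hz h) hzU
  have hnormal : ∀ v, IsOuterNormalAt (e ⁻¹' Ω) y v ↔ IsOuterNormalAt Ω (e y) v := fun v => by
    refine and_congr_right fun _ => ⟨fun h w hw => ?_, fun h w hw => ?_⟩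
    · have := h (e.symm w) (by simpa using hw)
      have hw' : w = p + e.symm w := (e.apply_symm_apply w).symm
      rw [hw', he, inner_add_left, inner_add_left]
      linarith
    · have := h (e w) hw
      rw [he, he, inner_add_left, inner_add_left] at this
      linarith
  refine ⟨e z, hz, e y, ?_, u, (hnormal u).1 hu, fun v hv => huniq v ((hnormal v).2 hv), ?_⟩
  · rwa [← e.preimage_frontier] at hy
  · rw [he, he, inner_add_left, inner_add_left]
    linarith

/-- A convex body contains the intersection of its supporting half-spaces at regular points. -/
lemma mem_of_forall_regular_normal
    {Ω : Set (EuclideanSpace ℝ (Fin n))} (hcomp : IsCompact Ω) (hconv : Convex ℝ Ω)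
    (hint : (interior Ω).Nonempty) {x : EuclideanSpace ℝ (Fin n)}
    (hx : ∀ y ∈ frontier Ω, ∀ u, IsOuterNormalAt Ω y u →
      (∀ v, IsOuterNormalAt Ω y v → v = u) → ⟪x, u⟫ ≤ ⟪y, u⟫) : x ∈ Ω := by
  let C : Set (EuclideanSpace ℝ (Fin n)) := {x | ∀ y ∈ frontier Ω, ∀ u, IsOuterNormalAt Ω y u →
      (∀ v, IsOuterNormalAt Ω y v → v = u) → ⟪x, u⟫ ≤ ⟪y, u⟫}
  have hΩC : Ω ⊆ C := fun w hw y _ u hu _ => hu.2 w hw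
  have hC : Convex ℝ C := by
    intro a ha b hb α β hα hβ hαβ y hy u hu huniq
    have h1 := mul_le_mul_of_nonneg_left (ha y hy u hu huniq) hα
    have h2 := mul_le_mul_of_nonneg_left (hb y hy u hu huniq) hβ
    rw [inner_add_left, real_inner_smul_left, real_inner_smul_left]
    calc _ ≤ α * ⟪y, u⟫ + β * ⟪y, u⟫ := add_le_add h1 h2
      _ = ⟪y, u⟫ := by rw [← add_mul, hαβ, one_mul]
  have hsub : interior C ⊆ Ω := by
    by_contra h
    obtain ⟨w, hwC, hwΩ⟩ := not_subset.1 h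
    obtain ⟨z, hz, y, hy, u, hu, huniq, hlt⟩ := exists_regular_normal_of_isOpen hcomp hconv hint
      (isOpen_interior.sdiff hcomp.isClosed) ⟨w, hwC, hwΩ⟩ disjoint_sdiff_left
    exact hlt.not_ge (interior_subset hz.1 y hy u hu huniq)
  have hcl := hC.closure_interior_eq_closure_of_nonempty_interior (hint.mono (interior_mono hΩC))
  exact closure_minimal hsub hcomp.isClosed (hcl ▸ subset_closure (show x ∈ C from hx))

/-- The form body contains the unit ball. -/
lemma closedBall_subset_formBody (Ω : Set (EuclideanSpace ℝ (Fin n))) :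
    closedBall 0 1 ⊆ formBody Ω := by
  intro b hb
  refine mem_iInter₂.2 fun u hu => ?_
  obtain ⟨y, -, hn, -⟩ := hu
  refine (real_inner_le_norm b u).trans ?_
  rw [hn.1, mul_one]
  simpa using hb

/-- For a convex body `Ω` and `t ≥ 0`, `(Ω + t Ω_*) ∼ tB = Ω`. -/
theorem minkDiff_add_smul_formBody
    (Ω : Set (EuclideanSpace ℝ (Fin n))) (hcomp : IsCompact Ω) (hconv : Convex ℝ Ω)
    (hint : (interior Ω).Nonempty) (t : ℝ) (ht : 0 ≤ t) :
    minkDiff (Ω + t • formBody Ω) (t • closedBall (0 : EuclideanSpace ℝ (Fin n)) 1) = Ω := by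
  refine Subset.antisymm (fun x hx => ?_) fun x hx b hb =>
    add_mem_add hx (smul_set_mono (closedBall_subset_formBody Ω) hb)
  refine mem_of_forall_regular_normal hcomp hconv hint fun y hy u hu huniq => ?_
  obtain ⟨w, hw, _, ⟨c, hc, rfl⟩, hsum⟩ :=
    hx (t • u) (smul_mem_smul_set (by simp [hu.1]))
  have hcu : ⟪c, u⟫ ≤ 1 := mem_iInter₂.1 hc u ⟨y, hy, hu, huniq⟩
  have hinner := congrArg (fun a => ⟪a, u⟫) hsum
  simp only [inner_add_left, real_inner_smul_left, real_inner_self_eq_norm_sq, hu.1] at hinner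
  have := hu.2 w hw
  nlinarith
end
end

section
/- Let Ω ⊂ ℝⁿ be a convex body, t ≥ 0, and let Ω̂ ⊂ ℝⁿ be a convex body with Ω̂ ∼ tB = Ω. Then for every outward unit normal u at a regular point of ∂Ω (i.e. every u ∈ regn(Ω)) the support functions satisfy h(Ω̂, u) = h(Ω, u) + t. -/
open Metric MeasureTheory Set
open scoped ENNReal RealInnerProductSpace Pointwise

noncomputable section

variable {n : ℕ}

/-- A point outside the interior of a convex set with nonempty interior is weakly separated from
it by a unit vector. -/
lemma exists_isOuterNormalAt_of_notMem_interior {K : Set (EuclideanSpace ℝ (Fin n))}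
    (hK : Convex ℝ K) (hint : (interior K).Nonempty) {p : EuclideanSpace ℝ (Fin n)}
    (hp : p ∉ interior K) : ∃ v, IsOuterNormalAt K p v := by
  obtain ⟨f, hf⟩ := geometric_hahn_banach_open_point hK.interior isOpen_interior hp
  have hle : ∀ z ∈ K, f z ≤ f p := by
    intro z hz
    have hz' : z ∈ closure (interior K) := by
      rw [hK.closure_interior_eq_closure_of_nonempty_interior hint]
      exact subset_closure hz
    exact closure_minimal (t := {a | f a ≤ f p}) (fun a ha => (hf a ha).le)
      (isClosed_le f.continuous continuous_const) hz'
  obtain ⟨a, ha⟩ := hint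
  set w := (InnerProductSpace.toDual ℝ (EuclideanSpace ℝ (Fin n))).symm f with hw
  have hfw : ∀ z, ⟪z, w⟫ = f z := fun z => by
    rw [real_inner_comm, hw, InnerProductSpace.toDual_symm_apply]
  have hw0 : w ≠ 0 := by
    intro h0
    have h := hf a ha
    rw [← hfw, ← hfw, h0, inner_zero_right, inner_zero_right] at h
    exact lt_irrefl _ h
  refine ⟨‖w‖⁻¹ • w, norm_smul_inv_norm hw0, fun z hz => ?_⟩
  rw [real_inner_smul_right, real_inner_smul_right, hfw, hfw]
  exact mul_le_mul_of_nonneg_left (hle z hz) (by positivity)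

/-- Membership in the Minkowski difference with the ball `tB` means containing the closed ball
of radius `t`. -/
lemma mem_minkDiff_smul_closedBall {K : Set (EuclideanSpace ℝ (Fin n))} {t : ℝ} (ht : 0 ≤ t)
    {x : EuclideanSpace ℝ (Fin n)} :
    x ∈ minkDiff K (t • closedBall (0 : EuclideanSpace ℝ (Fin n)) 1) ↔ closedBall x t ⊆ K := by
  rw [smul_unitClosedBall_of_nonneg ht]
  constructor
  · intro h z hz
    have := h (z - x) (by simpa [dist_eq_norm] using hz)
    simpa using this
  · intro h y hy
    exact h (by simpa [dist_eq_norm] using hy)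

/-- The ball of radius `t` around a boundary point of `K ∼ tB` is not contained in the interior
of `K`. -/
lemma exists_mem_closedBall_notMem_interior {K : Set (EuclideanSpace ℝ (Fin n))} {t : ℝ}
    (ht : 0 ≤ t) {x : EuclideanSpace ℝ (Fin n)}
    (hx : x ∉ interior (minkDiff K (t • closedBall (0 : EuclideanSpace ℝ (Fin n)) 1))) :
    ∃ p ∈ closedBall x t, p ∉ interior K := by
  by_contra! h
  obtain ⟨δ, hδ, hsub⟩ :=
    (isCompact_closedBall x t).exists_thickening_subset_open isOpen_interior h
  refine hx (mem_interior.2 ⟨ball x δ, fun y hy => ?_, isOpen_ball, mem_ball_self hδ⟩)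
  rw [mem_minkDiff_smul_closedBall ht]
  intro z hz
  refine interior_subset (hsub (mem_thickening_iff.2 ⟨z - y + x, ?_, ?_⟩))
  · simpa [dist_eq_norm] using hz
  · rw [mem_ball, dist_eq_norm] at hy
    rw [dist_eq_norm]
    convert hy using 2
    abel

/-- The support function at an outer normal of `Ω` is attained at the contact point. -/
lemma supportFn_eq_of_isOuterNormalAt {Ω : Set (EuclideanSpace ℝ (Fin n))}
    {x u : EuclideanSpace ℝ (Fin n)} (hx : x ∈ Ω) (h : IsOuterNormalAt Ω x u) :
    supportFn Ω u = ⟪x, u⟫ :=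
  IsGreatest.csSup_eq ⟨mem_image_of_mem _ hx, forall_mem_image.2 h.2⟩

/-- If `Ω̂` is a convex body with `Ω̂ ∼ tB = Ω`, then for every
`u ∈ regn Ω` the support functions satisfy `h(Ω̂, u) = h(Ω, u) + t`. -/
theorem supportFn_eq_add_of_minkDiff_eq
    (Ω : Set (EuclideanSpace ℝ (Fin n))) (hcomp : IsCompact Ω) (hconv : Convex ℝ Ω)
    (hint : (interior Ω).Nonempty) (t : ℝ) (ht : 0 ≤ t)
    (Ωhat : Set (EuclideanSpace ℝ (Fin n))) (hcomp' : IsCompact Ωhat)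
    (hconv' : Convex ℝ Ωhat) (hint' : (interior Ωhat).Nonempty)
    (hdiff : minkDiff Ωhat (t • closedBall (0 : EuclideanSpace ℝ (Fin n)) 1) = Ω) :
    ∀ u ∈ regn Ω, supportFn Ωhat u = supportFn Ω u + t := by
  rintro u ⟨x, hx, hu, huniq⟩
  have hxΩ : x ∈ Ω := hcomp.isClosed.frontier_subset hx
  have hball : ∀ y ∈ Ω, ∀ v : EuclideanSpace ℝ (Fin n), ‖v‖ = 1 → y + t • v ∈ Ωhat := by
    intro y hy v hv
    rw [← hdiff, mem_minkDiff_smul_closedBall ht] at hy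
    exact hy (by simp [dist_eq_norm, norm_smul, hv, abs_of_nonneg ht])
  have hinner : ∀ y v : EuclideanSpace ℝ (Fin n), ‖v‖ = 1 → ⟪y + t • v, v⟫ = ⟪y, v⟫ + t := by
    intro y v hv
    rw [inner_add_left, real_inner_smul_left, real_inner_self_eq_norm_sq, hv]
    ring
  obtain ⟨p, hp, hpint⟩ := exists_mem_closedBall_notMem_interior (K := Ωhat) ht
    (x := x) (by rw [hdiff]; exact hx.2)
  obtain ⟨v, hv, hvle⟩ := exists_isOuterNormalAt_of_notMem_interior hconv' hint' hpint
  have hpv : ⟪p, v⟫ ≤ ⟪x, v⟫ + t := by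
    have h := real_inner_le_norm (p - x) v
    rw [hv, mul_one, inner_sub_left] at h
    rw [mem_closedBall, dist_eq_norm] at hp
    linarith
  have hvu : v = u := huniq v ⟨hv, fun y hy => by
    have h := hvle _ (hball y hy v hv)
    rw [hinner y v hv] at h
    linarith⟩
  subst hvu
  have hnormal : IsOuterNormalAt Ωhat (x + t • v) v :=
    ⟨hv, fun z hz => by rw [hinner x v hv]; exact (hvle z hz).trans hpv⟩
  rw [supportFn_eq_of_isOuterNormalAt hxΩ hu,
    supportFn_eq_of_isOuterNormalAt (hball x hxΩ v hv) hnormal, hinner x v hv]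
end
end
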